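/- Let α be a real number and let p/q be a fraction in lowest terms with q ≥ 1 and p/q ≠ α. Write α − p/q = θ/q². Let p/q = [a₀; a₁, …, aₙ] be the continued fraction expansion of p/q chosen (among its two expansions) so that n is even if θ > 0 and n is odd if θ < 0, and let p′/q′ = [a₀; a₁, …, aₙ₋₁] in lowest terms be its second-to-last convergent. Then p/q is a convergent of α (if α is rational, of at least one of its two continued fraction expansions) if and only if |θ| ≤ q/(q + q′). -/

import Mathlib

open Filter Topology

/-- Value of the finite continued fraction `[a₀; a₁, …, aₙ]`, where the partial
quotients `a₁, …, aₙ` are given as the list `l`. -/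
def cfq : ℤ → List ℕ → ℚ
  | a, [] => (a : ℚ)
  | a, b :: l => (a : ℚ) + (cfq (b : ℤ) l)⁻¹

/-- Continuants: `cfPair a₀ [a₁,…,aₙ] = ((pₙ, pₙ₋₁), (qₙ, qₙ₋₁))`, the numerators and
denominators (in lowest terms) of the last two convergents of `[a₀; a₁, …, aₙ]`,
with the usual conventions `p₋₁ = 1`, `q₋₁ = 0`. -/
def cfPair (a₀ : ℤ) (l : List ℕ) : (ℤ × ℤ) × (ℤ × ℤ) :=
  l.foldl (fun pq b => (((b : ℤ) * pq.1.1 + pq.1.2, pq.1.1), ((b : ℤ) * pq.2.1 + pq.2.2, pq.2.1)))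
    ((a₀, 1), (1, 0))

/-- The list of the first `n` terms of the sequence `a`. -/
def pref (a : ℕ → ℕ) (n : ℕ) : List ℕ := List.ofFn fun i : Fin n => a i

/-- `x` is a convergent of a continued fraction expansion of `α` (if `α` is rational this
means: a convergent of at least one of its two finite expansions; if `α` is irrational,
of its unique infinite expansion, an expansion of `α` being a continued fraction with
positive integer partial quotients whose convergents tend to `α`). -/
def IsConvergentOf (x : ℚ) (α : ℝ) : Prop :=
  (∃ (a₀ : ℤ) (l : List ℕ), (∀ b ∈ l, 0 < b) ∧ ((cfq a₀ l : ℚ) : ℝ) = α ∧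
    ∃ k, cfq a₀ (l.take k) = x) ∨
  (∃ (a₀ : ℤ) (a : ℕ → ℕ), (∀ i, 0 < a i) ∧
    Tendsto (fun n => ((cfq a₀ (pref a n) : ℚ) : ℝ)) atTop (nhds α) ∧
    ∃ n, cfq a₀ (pref a n) = x)

/-- `x'` and `x` are two consecutive convergents (in this order) of a continued fraction
expansion of `α`. -/
def ConsecConvergentsOf (x' x : ℚ) (α : ℝ) : Prop :=
  (∃ (a₀ : ℤ) (l : List ℕ), (∀ b ∈ l, 0 < b) ∧ ((cfq a₀ l : ℚ) : ℝ) = α ∧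
    ∃ k, k + 1 ≤ l.length ∧ cfq a₀ (l.take k) = x' ∧ cfq a₀ (l.take (k + 1)) = x) ∨
  (∃ (a₀ : ℤ) (a : ℕ → ℕ), (∀ i, 0 < a i) ∧
    Tendsto (fun n => ((cfq a₀ (pref a n) : ℚ) : ℝ)) atTop (nhds α) ∧
    ∃ k, cfq a₀ (pref a k) = x' ∧ cfq a₀ (pref a (k + 1)) = x)

/-- `α` admits a (finite or infinite) continued fraction expansion `[0; l, …]`
beginning with the partial quotients in `l`. -/
def cfBegins (l : List ℕ) (α : ℝ) : Prop :=
  (∃ m : List ℕ, (∀ b ∈ m, 0 < b) ∧ ((cfq 0 (l ++ m) : ℚ) : ℝ) = α) ∨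
  (∃ a : ℕ → ℕ, (∀ i, 0 < a i) ∧
    Tendsto (fun n => ((cfq 0 (l ++ pref a n) : ℚ) : ℝ)) atTop (nhds α))

/-- The cylinder `E(a₁,…,aₙ)`: all `α ∈ [0,1]` admitting a (finite or infinite)
continued fraction expansion beginning with the partial quotients `a₁, …, aₙ`. -/
def cfCylinder (l : List ℕ) : Set ℝ := {α : ℝ | α ∈ Set.Icc (0 : ℝ) 1 ∧ cfBegins l α}

/-- The Farey sequence of order `q`: all fractions in `[0,1]` whose denominator in
lowest terms is at most `q`. -/
def FareySet (q : ℕ) : Set ℚ := {x : ℚ | 0 ≤ x ∧ x ≤ 1 ∧ x.den ≤ q}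

/-- `rlo` and `rhi` are the two neighbors of `x` in the Farey sequence of order `q`. -/
def FareyNeighbors (q : ℕ) (x rlo rhi : ℚ) : Prop :=
  rlo ∈ FareySet q ∧ rhi ∈ FareySet q ∧ rlo < x ∧ x < rhi ∧
    (∀ y ∈ FareySet q, y < x → y ≤ rlo) ∧ (∀ y ∈ FareySet q, x < y → rhi ≤ y)

noncomputable def cfVal (a : ℤ) (l : List ℕ) (x : ℝ) : ℝ :=
  (x * (cfPair a l).1.1 + (cfPair a l).1.2) / (x * (cfPair a l).2.1 + (cfPair a l).2.2)

theorem cfPair_append (a : ℤ) (l : List ℕ) (c : ℕ) : cfPair a (l ++ [c]) =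
    (((c : ℤ) * (cfPair a l).1.1 + (cfPair a l).1.2, (cfPair a l).1.1),
      ((c : ℤ) * (cfPair a l).2.1 + (cfPair a l).2.2, (cfPair a l).2.1)) := by
  simp [cfPair, List.foldl_append]

theorem cfPair_det (a : ℤ) (l : List ℕ) :
    (cfPair a l).1.2 * (cfPair a l).2.1 - (cfPair a l).1.1 * (cfPair a l).2.2
      = (-1) ^ l.length := by
  induction l using List.reverseRecOn with
  | nil => simp [cfPair]
  | append_singleton l c ih =>
    rw [cfPair_append]
    simp only [List.length_append, List.length_singleton, pow_succ]
    rw [← ih]; ring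

theorem cfPair_bounds (a : ℤ) (l : List ℕ) (hl : ∀ b ∈ l, 0 < b) :
    1 ≤ (cfPair a l).2.1 ∧ 0 ≤ (cfPair a l).2.2 ∧
      (l.length : ℤ) + 1 ≤ (cfPair a l).2.1 + (cfPair a l).2.2 := by
  induction l using List.reverseRecOn with
  | nil => simp [cfPair]
  | append_singleton l c ih =>
    obtain ⟨h1, h2, h3⟩ := ih (fun b hb => hl b (by simp [hb]))
    have hc : (1 : ℤ) ≤ c := by exact_mod_cast hl c (by simp)
    rw [cfPair_append]
    simp only [List.length_append, List.length_singleton]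
    push_cast
    refine ⟨by nlinarith, by linarith, by nlinarith⟩

theorem cfq_ge (b : ℕ) (t : List ℕ) (hb : 0 < b) (ht : ∀ c ∈ t, 0 < c) :
    (1 : ℚ) ≤ cfq b t ∧ (t ≠ [] → (1 : ℚ) < cfq b t) := by
  induction t generalizing b with
  | nil => simp [cfq]; exact hb
  | cons c t ih =>
    have h := (ih c (ht c (by simp)) (fun d hd => ht d (by simp [hd]))).1
    have h' : (0 : ℚ) < (cfq c t)⁻¹ := by positivity
    have hb' : (1 : ℚ) ≤ b := by exact_mod_cast hb
    simp only [cfq]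
    push_cast
    exact ⟨by linarith, fun _ => by linarith⟩

theorem cfVal_append (a : ℤ) (l : List ℕ) (hl : ∀ b ∈ l, 0 < b) (c : ℕ) (y : ℝ) (hy : 0 < y) :
    cfVal a (l ++ [c]) y = cfVal a l (c + y⁻¹) := by
  obtain ⟨h1, h2, -⟩ := cfPair_bounds a l hl
  have h1' : (1 : ℝ) ≤ (cfPair a l).2.1 := by exact_mod_cast h1
  have h2' : (0 : ℝ) ≤ (cfPair a l).2.2 := by exact_mod_cast h2
  unfold cfVal
  rw [cfPair_append]
  push_cast
  generalize ((cfPair a l).2.1 : ℝ) = q at *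
  generalize ((cfPair a l).2.2 : ℝ) = q' at *
  generalize ((cfPair a l).1.1 : ℝ) = p at *
  generalize ((cfPair a l).1.2 : ℝ) = p' at *
  have hc : (0 : ℝ) ≤ c := Nat.cast_nonneg c
  have e1 : y * (c * q + q') + q ≠ 0 := by positivity
  have e2 : (c + y⁻¹) * q + q' ≠ 0 := by positivity
  rw [div_eq_div_iff e1 e2]
  field_simp
  ring

theorem cfq_append (a : ℤ) (l : List ℕ) (hl : ∀ b ∈ l, 0 < b) (b : ℕ) (t : List ℕ)
    (hb : 0 < b) (ht : ∀ c ∈ t, 0 < c) :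
    ((cfq a (l ++ b :: t) : ℚ) : ℝ) = cfVal a l (cfq b t : ℚ) := by
  induction l using List.reverseRecOn generalizing b t with
  | nil =>
    have h : (1 : ℝ) ≤ (cfq b t : ℚ) := by exact_mod_cast (cfq_ge b t hb ht).1
    have e : cfPair a [] = ((a, 1), (1, 0)) := by simp [cfPair]
    simp only [cfVal, e, cfq, List.nil_append]
    push_cast
    have : ((cfq b t : ℚ) : ℝ) ≠ 0 := by positivity
    field_simp
    simp
    ring
  | append_singleton l c ih =>
    have hc : 0 < c := hl c (by simp)
    have hl' : ∀ b ∈ l, 0 < b := fun b hb => hl b (by simp [hb])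
    have h : (1 : ℝ) ≤ (cfq b t : ℚ) := by exact_mod_cast (cfq_ge b t hb ht).1
    rw [cfVal_append a l hl' c _ (by linarith)]
    have := ih hl' c (b :: t) hc (by
      intro d hd
      rcases List.mem_cons.1 hd with rfl | hd
      · exact hb
      · exact ht d hd)
    simp only [List.append_assoc, List.singleton_append]
    rw [this]
    simp [cfq]

theorem cfq_eq (a : ℤ) (l : List ℕ) (hl : ∀ b ∈ l, 0 < b) :
    ((cfq a l : ℚ) : ℝ) = (cfPair a l).1.1 / (cfPair a l).2.1 := by
  rcases List.eq_nil_or_concat' l with rfl | ⟨l, c, rfl⟩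
  · simp [cfq, cfPair]
  · rw [cfq_append a l (fun b hb => hl b (by simp [hb])) c [] (hl c (by simp)) (by simp),
      cfPair_append]
    simp [cfVal, cfq]

theorem cfVal_sub (a : ℤ) (l : List ℕ) (hl : ∀ b ∈ l, 0 < b) (x : ℝ) (hx : 0 < x) :
    cfVal a l x - (cfq a l : ℚ) = (-1) ^ l.length /
      ((cfPair a l).2.1 * (x * (cfPair a l).2.1 + (cfPair a l).2.2)) := by
  obtain ⟨h1, h2, -⟩ := cfPair_bounds a l hl
  have h1' : (1 : ℝ) ≤ (cfPair a l).2.1 := by exact_mod_cast h1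
  have h2' : (0 : ℝ) ≤ (cfPair a l).2.2 := by exact_mod_cast h2
  have hd : ((cfPair a l).1.2 * (cfPair a l).2.1 - (cfPair a l).1.1 * (cfPair a l).2.2 : ℝ)
      = (-1) ^ l.length := by exact_mod_cast cfPair_det a l
  rw [cfq_eq a l hl, cfVal, ← hd]
  have e1 : (x * (cfPair a l).2.1 + (cfPair a l).2.2 : ℝ) ≠ 0 := by positivity
  have e2 : ((cfPair a l).2.1 : ℝ) ≠ 0 := by positivity
  field_simp
  ring

theorem cfq_inj (l : List ℕ) : ∀ (l' : List ℕ) (a a' : ℤ), (∀ b ∈ l, 0 < b) →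
    (∀ b ∈ l', 0 < b) → (Even l.length ↔ Even l'.length) → cfq a l = cfq a' l' →
    a = a' ∧ l = l' := by
  have aux : ∀ (a a' : ℤ) (l : List ℕ), (∀ b ∈ l, 0 < b) → l ≠ [] → Even l.length →
      (a : ℚ) = cfq a' l → False := by
    intro a a' l hl hne hev h
    match l, hl, hne, hev, h with
    | [], _, hne, _, _ => exact hne rfl
    | [b], _, _, hev, _ => simp at hev
    | b :: c :: t, hl, _, _, h =>
      have h1 := (cfq_ge b (c :: t) (hl b (by simp)) (fun d hd => hl d (by simp [hd]))).2 (by simp)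
      rw [cfq] at h
      have h2 : (0 : ℚ) < (cfq b (c :: t))⁻¹ := by positivity
      have h3 : (cfq b (c :: t))⁻¹ < 1 := inv_lt_one_of_one_lt₀ h1
      have h4 : (a' : ℚ) < a := by linarith
      have h5 : (a : ℚ) < a' + 1 := by linarith
      norm_cast at h4 h5
      omega
  induction l with
  | nil =>
    intro l' a a' _ hl' hev h
    by_cases hn : l' = []
    · subst hn; simpa [cfq] using h
    · exact (aux a a' l' hl' hn (hev.1 (by simp)) (by simpa [cfq] using h)).elim
  | cons b t ih =>
    intro l' a a' hl hl' hev h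
    match l', hl', hev, h with
    | [], _, hev, h =>
      exact (aux a' a (b :: t) hl (by simp) (hev.2 (by simp)) (by simpa [cfq] using h.symm)).elim
    | b' :: t', hl', hev, h =>
      have ht : ∀ c ∈ t, 0 < c := fun d hd => hl d (by simp [hd])
      have ht' : ∀ c ∈ t', 0 < c := fun d hd => hl' d (by simp [hd])
      have h1 := (cfq_ge b t (hl b (by simp)) ht).1
      have h1' := (cfq_ge b' t' (hl' b' (by simp)) ht').1
      rw [cfq, cfq] at h
      have h2 : (0 : ℚ) < (cfq b t)⁻¹ := by positivity
      have h3 : (cfq b t)⁻¹ ≤ 1 := inv_le_one_of_one_le₀ h1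
      have h2' : (0 : ℚ) < (cfq b' t')⁻¹ := by positivity
      have h3' : (cfq b' t')⁻¹ ≤ 1 := inv_le_one_of_one_le₀ h1'
      have h4 : (a : ℚ) < a' + 1 := by linarith
      have h5 : (a' : ℚ) < a + 1 := by linarith
      norm_cast at h4 h5
      have ha : a = a' := by omega
      subst ha
      have h6 : cfq b t = cfq b' t' := inv_injective (by linarith)
      have hev' : Even t.length ↔ Even t'.length := by
        simp only [List.length_cons, Nat.even_add_one] at hev
        tauto
      obtain ⟨hb, htt⟩ := ih t' b b' ht ht' hev' h6
      refine ⟨rfl, ?_⟩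
      rw [htt, Nat.cast_injective hb]

theorem exists_finite (n : ℕ) : ∀ r : ℚ, r.den ≤ n → 1 ≤ r →
    ∃ (b : ℕ) (t : List ℕ), 0 < b ∧ (∀ c ∈ t, 0 < c) ∧ cfq b t = r := by
  induction n with
  | zero => intro r h; have := r.den_pos; omega
  | succ n ih =>
    intro r hn hr
    have hfl : (1 : ℤ) ≤ ⌊r⌋ := Int.le_floor.2 (by exact_mod_cast hr)
    obtain ⟨b, hb⟩ := Int.eq_ofNat_of_zero_le (show 0 ≤ ⌊r⌋ by omega)
    have hb0 : 0 < b := by omega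
    by_cases hf : Int.fract r = 0
    · refine ⟨b, [], hb0, by simp, ?_⟩
      have := Int.floor_add_fract r
      rw [hf, hb] at this
      simpa [cfq] using this
    · have hpos : 0 < Int.fract r := lt_of_le_of_ne (Int.fract_nonneg r) (Ne.symm hf)
      have hlt := Int.fract_lt_one r
      have hden : (Int.fract r).den = r.den := by
        rw [Int.fract, Rat.sub_intCast_den]
      have hnum : 0 < (Int.fract r).num := Rat.num_pos.2 hpos
      have hnl : (Int.fract r).num < (Int.fract r).den := by
        rw [← Rat.num_div_den (Int.fract r), div_lt_one (by exact_mod_cast (Int.fract r).den_pos)] at hlt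
        exact_mod_cast hlt
      obtain ⟨c, t, hc, ht, he⟩ := ih (Int.fract r)⁻¹ (by
        rw [Rat.den_inv_of_ne_zero hf]; omega) ((one_le_inv₀ hpos).2 hlt.le)
      refine ⟨b, c :: t, hb0, ?_, ?_⟩
      · intro d hd
        rcases List.mem_cons.1 hd with rfl | hd
        · exact hc
        · exact ht d hd
      · rw [cfq, he, inv_inv]
        have := Int.floor_add_fract r
        rw [hb] at this
        simpa using this

theorem pref_succ (a : ℕ → ℕ) (n : ℕ) : pref a (n + 1) = pref a n ++ [a n] := by
  rw [pref, List.ofFn_succ_last]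
  simp [pref]

theorem pref_pos (a : ℕ → ℕ) (ha : ∀ i, 0 < a i) (n : ℕ) : ∀ b ∈ pref a n, 0 < b := by
  intro b hb
  simp only [pref, List.mem_ofFn] at hb
  obtain ⟨i, rfl⟩ := hb
  exact ha _

theorem pref_length (a : ℕ → ℕ) (n : ℕ) : (pref a n).length = n := by simp [pref]

theorem pref_take (a : ℕ → ℕ) (n m : ℕ) (h : n ≤ m) : (pref a m).take n = pref a n := by
  apply List.ext_getElem
  · simp [pref, h]
  · intro i h1 h2
    simp [pref]

noncomputable def tailSeq (x : ℝ) : ℕ → ℝ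
  | 0 => x
  | n + 1 => (Int.fract (tailSeq x n))⁻¹

theorem tailSeq_prop (x : ℝ) (hx : 1 ≤ x) (hi : Irrational x) (n : ℕ) :
    1 ≤ tailSeq x n ∧ Irrational (tailSeq x n) := by
  induction n with
  | zero => exact ⟨hx, hi⟩
  | succ n ih =>
    have h : Irrational (Int.fract (tailSeq x n)) := by
      rw [Int.fract]; exact ih.2.sub_intCast _
    refine ⟨?_, h.inv⟩
    have hpos : 0 < Int.fract (tailSeq x n) :=
      lt_of_le_of_ne (Int.fract_nonneg _) (Ne.symm h.ne_zero)
    exact (one_le_inv₀ hpos).2 (Int.fract_lt_one _).le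

/-- Every number of the form `[a; l, x]` with `1 ≤ x` has `[a; l]` as a convergent. -/
theorem isConvergentOf_cfVal (a : ℤ) (l : List ℕ) (hl : ∀ b ∈ l, 0 < b) (x : ℝ) (hx : 1 ≤ x) :
    IsConvergentOf (cfq a l) (cfVal a l x) := by
  by_cases hi : Irrational x
  · right
    set c : ℕ → ℕ := fun n => ⌊tailSeq x n⌋₊ with hc
    have hcpos : ∀ i, 0 < c i := fun i => Nat.floor_pos.2 (tailSeq_prop x hx hi i).1
    set s : ℕ → ℕ := fun i => if h : i < l.length then l[i] else c (i - l.length) with hs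
    have hspos : ∀ i, 0 < s i := by
      intro i
      simp only [hs]
      split_ifs with h
      · exact hl _ (List.getElem_mem h)
      · exact hcpos _
    have hpl : pref s l.length = l := by
      apply List.ext_getElem
      · simp [pref]
      · intro i h1 h2
        simp [pref, hs, h2]
    have hval : ∀ n, cfVal a (pref s (n + l.length)) (tailSeq x n) = cfVal a l x := by
      intro n
      induction n with
      | zero => rw [zero_add, hpl]; rfl
      | succ n ih =>
        have hp := tailSeq_prop x hx hi n
        have hp' := tailSeq_prop x hx hi (n + 1)
        rw [show n + 1 + l.length = n + l.length + 1 by omega, pref_succ,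
          cfVal_append _ _ (pref_pos s hspos _) _ _ (by linarith [hp'.1]), ← ih]
        congr 1
        have : s (n + l.length) = ⌊tailSeq x n⌋₊ := by simp [hs, hc]
        rw [this, tailSeq, inv_inv, natCast_floor_eq_intCast_floor (by linarith [hp.1])]
        exact Int.floor_add_fract _
    refine ⟨a, s, hspos, ?_, l.length, by rw [hpl]⟩
    rw [← tendsto_add_atTop_iff_nat l.length, tendsto_iff_dist_tendsto_zero]
    refine squeeze_zero (fun _ => dist_nonneg) (fun n => ?_) tendsto_one_div_add_atTop_nhds_zero_nat
    have hp := tailSeq_prop x hx hi n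
    have hpp := pref_pos s hspos (n + l.length)
    rw [dist_comm, Real.dist_eq, ← hval n, cfVal_sub _ _ hpp _ (by linarith [hp.1])]
    obtain ⟨h1, h2, h3⟩ := cfPair_bounds a _ hpp
    rw [pref_length] at h3
    have h1' : (1 : ℝ) ≤ (cfPair a (pref s (n + l.length))).2.1 := by exact_mod_cast h1
    have h2' : (0 : ℝ) ≤ (cfPair a (pref s (n + l.length))).2.2 := by exact_mod_cast h2
    have h3' : (n : ℝ) + l.length + 1 ≤ (cfPair a (pref s (n + l.length))).2.1 +
      (cfPair a (pref s (n + l.length))).2.2 := by exact_mod_cast h3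
    generalize ((cfPair a (pref s (n + l.length))).2.1 : ℝ) = q at *
    generalize ((cfPair a (pref s (n + l.length))).2.2 : ℝ) = q' at *
    have hxx := hp.1
    have hL : (0 : ℝ) ≤ l.length := Nat.cast_nonneg _
    rw [abs_div, abs_pow, abs_neg, abs_one, one_pow, abs_of_nonneg (by positivity)]
    apply one_div_le_one_div_of_le (by positivity)
    have e1 : q ≤ tailSeq x n * q := by nlinarith
    nlinarith
  · left
    obtain ⟨r, rfl⟩ := not_not.1 hi
    obtain ⟨b, t, hb, ht, he⟩ := exists_finite r.den r le_rfl (by exact_mod_cast hx)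
    refine ⟨a, l ++ b :: t, ?_, ?_, l.length, by simp⟩
    · intro d hd
      rcases List.mem_append.1 hd with hd | hd
      · exact hl d hd
      rcases List.mem_cons.1 hd with rfl | hd
      · exact hb
      · exact ht d hd
    · rw [cfq_append a l hl b t hb ht, he]

/-- Prolonging `m` moves the value in a controlled way. -/
theorem cfq_prolong (a : ℤ) (m u : List ℕ) (hm : ∀ b ∈ m ++ u, 0 < b) :
    (-1 : ℝ) ^ m.length * (((cfq a (m ++ u) : ℚ) : ℝ) - (cfq a m : ℚ)) ∈
      Set.Icc (0 : ℝ) (1 / ((cfPair a m).2.1 * ((cfPair a m).2.1 + (cfPair a m).2.2))) := by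
  have hm' : ∀ b ∈ m, 0 < b := fun b hb => hm b (by simp [hb])
  obtain ⟨h1, h2, -⟩ := cfPair_bounds a m hm'
  have h1' : (1 : ℝ) ≤ (cfPair a m).2.1 := by exact_mod_cast h1
  have h2' : (0 : ℝ) ≤ (cfPair a m).2.2 := by exact_mod_cast h2
  match u, hm with
  | [], _ => simp only [List.append_nil, sub_self, mul_zero]; exact ⟨le_rfl, by positivity⟩
  | b :: t, hm =>
    have hb : 0 < b := hm b (by simp)
    have ht : ∀ c ∈ t, 0 < c := fun c hc => hm c (by simp [hc])
    have hx : (1 : ℝ) ≤ (cfq b t : ℚ) := by exact_mod_cast (cfq_ge b t hb ht).1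
    rw [cfq_append a m hm' b t hb ht, cfVal_sub a m hm' _ (by linarith), ← mul_div_assoc,
      ← pow_add, Even.neg_one_pow ⟨m.length, rfl⟩]
    generalize ((cfPair a m).2.1 : ℝ) = q at *
    generalize ((cfPair a m).2.2 : ℝ) = q' at *
    refine ⟨by positivity, ?_⟩
    apply one_div_le_one_div_of_le (by positivity)
    have e1 : q ≤ ((cfq b t : ℚ) : ℝ) * q := by nlinarith
    nlinarith

theorem convergent_bound (y : ℚ) (α : ℝ) (h : IsConvergentOf y α) :
    ∃ (a : ℤ) (m : List ℕ), (∀ b ∈ m, 0 < b) ∧ cfq a m = y ∧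
      (-1 : ℝ) ^ m.length * (α - (y : ℝ)) ∈
        Set.Icc (0 : ℝ) (1 / ((cfPair a m).2.1 * ((cfPair a m).2.1 + (cfPair a m).2.2))) := by
  rcases h with ⟨a, l, hl, rfl, k, rfl⟩ | ⟨a, s, hs, hlim, n, rfl⟩
  · refine ⟨a, l.take k, fun b hb => hl b (List.mem_of_mem_take hb), rfl, ?_⟩
    have := cfq_prolong a (l.take k) (l.drop k) (by rw [List.take_append_drop]; exact hl)
    rwa [List.take_append_drop] at this
  · refine ⟨a, pref s n, pref_pos s hs n, rfl, ?_⟩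
    refine isClosed_Icc.mem_of_tendsto ((hlim.sub_const _).const_mul _) ?_
    filter_upwards [eventually_ge_atTop n] with N hN
    have e : pref s n ++ (pref s N).drop n = pref s N := by
      rw [← pref_take s n N hN, List.take_append_drop]
    have := cfq_prolong a (pref s n) ((pref s N).drop n) (by rw [e]; exact pref_pos s hs N)
    rwa [e] at this

/-- **Legendre's criterion, non-strict form.** With `α - p/q = θ/q²`,
`p/q = [a₀; a₁, …, aₙ]` the expansion of `p/q` with `n` even if `θ > 0` and odd if
`θ < 0`, and `p'/q' = [a₀; a₁, …, aₙ₋₁]` its second-to-last convergent in lowest terms,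
`p/q` is a convergent of (an expansion of) `α` iff `|θ| ≤ q/(q + q')`. -/
theorem legendre_criterion (α : ℝ) (p q : ℤ) (hq : 1 ≤ q) (hcop : IsCoprime p q)
    (hne : (p : ℝ) / (q : ℝ) ≠ α) (θ : ℝ) (hθ : α - (p : ℝ) / (q : ℝ) = θ / (q : ℝ) ^ 2)
    (a₀ : ℤ) (l : List ℕ) (hl : ∀ b ∈ l, 0 < b)
    (hval : cfq a₀ l = (p : ℚ) / (q : ℚ))
    (hpar₁ : 0 < θ → Even l.length) (hpar₂ : θ < 0 → Odd l.length) :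
    IsConvergentOf ((p : ℚ) / (q : ℚ)) α ↔
      |θ| ≤ (q : ℝ) / ((q : ℝ) + ((cfPair a₀ l).2.2 : ℝ)) := by
  have hqR : (0 : ℝ) < q := by exact_mod_cast hq
  obtain ⟨h1, h2, -⟩ := cfPair_bounds a₀ l hl
  have hdet := cfPair_det a₀ l
  have hvR : ((cfq a₀ l : ℚ) : ℝ) = (p : ℝ) / q := by rw [hval]; push_cast; rfl
  -- `q` is the last continuant
  have hqq : (cfPair a₀ l).2.1 = q := by
    have hc2 : IsCoprime (cfPair a₀ l).1.1 (cfPair a₀ l).2.1 := by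
      rcases neg_one_pow_eq_or ℤ l.length with h | h <;> rw [h] at hdet
      · exact ⟨-(cfPair a₀ l).2.2, (cfPair a₀ l).1.2, by linarith⟩
      · exact ⟨(cfPair a₀ l).2.2, -(cfPair a₀ l).1.2, by linarith⟩
    have he := cfq_eq a₀ l hl
    rw [hvR, div_eq_div_iff hqR.ne' (by exact_mod_cast (by omega : (cfPair a₀ l).2.1 ≠ 0))] at he
    have he' : p * (cfPair a₀ l).2.1 = (cfPair a₀ l).1.1 * q := by exact_mod_cast he
    apply Int.dvd_antisymm (by omega) (by omega)
    · exact hc2.symm.dvd_of_dvd_mul_left ⟨p, by linarith⟩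
    · exact hcop.symm.dvd_of_dvd_mul_left ⟨(cfPair a₀ l).1.1, by linarith⟩
  have h2' : (0 : ℝ) ≤ (cfPair a₀ l).2.2 := by exact_mod_cast h2
  have hθ0 : θ ≠ 0 := by
    rintro rfl
    apply hne
    simp at hθ
    linarith
  have hsgn : (-1 : ℝ) ^ l.length * θ = |θ| := by
    rcases lt_or_gt_of_ne hθ0 with h | h
    · rw [(hpar₂ h).neg_one_pow, abs_of_neg h]; ring
    · rw [(hpar₁ h).neg_one_pow, abs_of_pos h]; ring
  have hpos : 0 < |θ| := abs_pos.2 hθ0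
  constructor
  · intro h
    obtain ⟨a, m, hm, hmv, hI⟩ := convergent_bound _ _ h
    have hcast : (((p : ℚ) / (q : ℚ) : ℚ) : ℝ) = (p : ℝ) / q := by push_cast; rfl
    rw [hcast, hθ, ← mul_div_assoc] at hI
    have hnn : 0 ≤ (-1 : ℝ) ^ m.length * θ := by
      have := hI.1
      rwa [le_div_iff₀ (by positivity), zero_mul] at this
    have hpar : Even l.length ↔ Even m.length := by
      rcases Nat.even_or_odd l.length with hle | hlo <;>
        rcases Nat.even_or_odd m.length with hme | hmo
      · simp [hle, hme]
      · rw [hle.neg_one_pow] at hsgn; rw [hmo.neg_one_pow] at hnn; linarith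
      · rw [hlo.neg_one_pow] at hsgn; rw [hme.neg_one_pow] at hnn; linarith
      · simp [Nat.not_even_iff_odd.2 hlo, Nat.not_even_iff_odd.2 hmo]
    obtain ⟨rfl, rfl⟩ := cfq_inj l m a₀ a hl hm hpar (hval.trans hmv.symm)
    have hb := hI.2
    rw [hsgn, hqq, div_le_div_iff₀ (by positivity) (by positivity)] at hb
    rw [le_div_iff₀ (by positivity)]
    have : q * (|θ| * (q + ((cfPair a₀ l).2.2 : ℝ))) ≤ q * (q : ℝ) := by linarith
    exact le_of_mul_le_mul_left this hqR
  · intro h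
    rw [le_div_iff₀ (by positivity)] at h
    obtain ⟨x, hx⟩ : ∃ x : ℝ, x = (q / |θ| - (cfPair a₀ l).2.2) / q := ⟨_, rfl⟩
    have hx1 : 1 ≤ x := by
      rw [hx, le_div_iff₀ hqR, le_sub_iff_add_le, one_mul, le_div_iff₀ hpos]
      linarith
    have hxq : x * q + (cfPair a₀ l).2.2 = q / |θ| := by
      rw [hx]; field_simp; ring
    have hα : cfVal a₀ l x = α := by
      have hs := cfVal_sub a₀ l hl x (by linarith)
      rw [hqq, hxq, hvR] at hs
      have hθ' : θ = (-1 : ℝ) ^ l.length * |θ| := by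
        rw [← hsgn, ← mul_assoc, ← pow_add, Even.neg_one_pow ⟨l.length, rfl⟩, one_mul]
      have : α - (p : ℝ) / q = (-1) ^ l.length / (q * (q / |θ|)) := by
        rw [hθ]
        nth_rewrite 1 [hθ']
        field_simp
      linarith
    have := isConvergentOf_cfVal a₀ l hl x hx1
    rwa [hα, hval] at this
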